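/- arXiv:0805.3477 — 2 statements merged into one kernel-verified Lean document; each statement's English description precedes it below -/
import Mathlib

section
/- Let φ : ℝ/ℤ → ℂ be continuous and κ ∈ (0,1). If there exist η ∈ ℕ with η ≥ 1 and C > 0 such that for all τ > 0, the sup norm of (∂/∂τ)^η e^{−τ√(−Δ)} φ is at most C τ^{κ−η}, then φ is κ-Hölder continuous: |φ(t) − φ(s)| ≤ C' |t−s|^κ for some C' and all t, s. -/
open Complex Real Set

instance : Fact ((0:ℝ) < 1) := ⟨one_pos⟩

open Filter Topology MeasureTheory AddCircle
open scoped ComplexConjugate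

/-- The `j`-th `τ`-derivative of the series `∑ k, e^{-2πτ|k|} c k`. -/
noncomputable def poissonSeries (c : ℤ → ℂ) (j : ℕ) (τ : ℝ) : ℂ :=
  ∑' k : ℤ, (((-(2 * π * |(k:ℝ)|)) ^ j * Real.exp (-(2 * π * τ * |(k:ℝ)|)) : ℝ) : ℂ) * c k

lemma summable_abs_pow_mul_exp (j : ℕ) {τ : ℝ} (hτ : 0 < τ) :
    Summable fun k : ℤ => |(k:ℝ)| ^ j * Real.exp (-(2 * π * τ * |(k:ℝ)|)) := by
  have h := Real.summable_pow_mul_exp_neg_nat_mul j (r := 2 * π * τ) (by positivity)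
  apply Summable.of_nat_of_neg <;> simpa using h

lemma norm_poissonSeries_term_le {c : ℤ → ℂ} {A : ℝ} (hc : ∀ k, ‖c k‖ ≤ A) (j : ℕ) (τ : ℝ)
    (k : ℤ) :
    ‖(((-(2 * π * |(k:ℝ)|)) ^ j * Real.exp (-(2 * π * τ * |(k:ℝ)|)) : ℝ) : ℂ) * c k‖ ≤
      A * (2 * π) ^ j * (|(k:ℝ)| ^ j * Real.exp (-(2 * π * τ * |(k:ℝ)|))) := by
  rw [norm_mul, Complex.norm_real, norm_mul, norm_pow, norm_neg,
    Real.norm_of_nonneg (by positivity : 0 ≤ 2 * π * |(k:ℝ)|),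
    Real.norm_of_nonneg (Real.exp_pos _).le, mul_pow]
  calc _ ≤ (2 * π) ^ j * |(k:ℝ)| ^ j * Real.exp (-(2 * π * τ * |(k:ℝ)|)) * A := by
        gcongr; exact hc k
    _ = _ := by ring

lemma summable_poissonSeries {c : ℤ → ℂ} {A : ℝ} (hc : ∀ k, ‖c k‖ ≤ A) (j : ℕ) {τ : ℝ}
    (hτ : 0 < τ) : Summable fun k : ℤ =>
      (((-(2 * π * |(k:ℝ)|)) ^ j * Real.exp (-(2 * π * τ * |(k:ℝ)|)) : ℝ) : ℂ) * c k :=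
  .of_norm_bounded ((summable_abs_pow_mul_exp j hτ).mul_left _)
    (norm_poissonSeries_term_le hc j τ)

lemma hasDerivAt_poissonSeries {c : ℤ → ℂ} {A : ℝ} (hc : ∀ k, ‖c k‖ ≤ A) (j : ℕ) {τ : ℝ}
    (hτ : 0 < τ) : HasDerivAt (poissonSeries c j) (poissonSeries c (j + 1) τ) τ := by
  have hA : 0 ≤ A := (norm_nonneg _).trans (hc 0)
  refine hasDerivAt_tsum_of_isPreconnected (t := Ioi (τ / 2)) (y₀ := τ)
    (g := fun (k : ℤ) y => (((-(2 * π * |(k:ℝ)|)) ^ j *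
      Real.exp (-(2 * π * y * |(k:ℝ)|)) : ℝ) : ℂ) * c k)
    (g' := fun (k : ℤ) y => (((-(2 * π * |(k:ℝ)|)) ^ (j + 1) *
      Real.exp (-(2 * π * y * |(k:ℝ)|)) : ℝ) : ℂ) * c k)
    ((summable_abs_pow_mul_exp (j + 1) (half_pos hτ)).mul_left (A * (2 * π) ^ (j + 1)))
    isOpen_Ioi isPreconnected_Ioi (fun k y _ => ?_) (fun k y hy => ?_) (half_lt_self hτ)
    (summable_poissonSeries hc j hτ) (half_lt_self hτ)
  · refine HasDerivAt.mul_const (HasDerivAt.ofReal_comp ?_) _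
    have h1 : HasDerivAt (fun y : ℝ => -(2 * π * y * |(k:ℝ)|)) (-(2 * π * 1 * |(k:ℝ)|)) y :=
      (((hasDerivAt_id y).const_mul (2 * π)).mul_const _).neg
    refine (h1.exp.const_mul ((-(2 * π * |(k:ℝ)|)) ^ j)).congr_deriv ?_
    ring
  · refine (norm_poissonSeries_term_le hc (j + 1) y k).trans ?_
    have : τ / 2 ≤ y := le_of_lt hy
    gcongr

lemma tendsto_poissonSeries_atTop {c : ℤ → ℂ} {A : ℝ} (hc : ∀ k, ‖c k‖ ≤ A) {j : ℕ}
    (h0 : j ≠ 0 ∨ c 0 = 0) : Tendsto (poissonSeries c j) atTop (𝓝 0) := by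
  have hA : 0 ≤ A := (norm_nonneg _).trans (hc 0)
  rw [← tsum_zero (β := ℤ)]
  refine tendsto_tsum_of_dominated_convergence
    ((summable_abs_pow_mul_exp j one_pos).mul_left (A * (2 * π) ^ j)) (fun k => ?_) ?_
  · rcases eq_or_ne k 0 with rfl | hk
    · rcases h0 with h | h <;> simp [h]
    · have hk' : 0 < 2 * π * |(k:ℝ)| := by positivity
      have h1 : Tendsto (fun τ : ℝ => Real.exp (-(2 * π * τ * |(k:ℝ)|))) atTop (𝓝 0) := by
        refine Real.tendsto_exp_neg_atTop_nhds_zero.comp ?_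
        refine (tendsto_id.const_mul_atTop hk').congr fun τ => ?_
        simp only [id]; ring
      have h2 := (h1.const_mul ((-(2 * π * |(k:ℝ)|)) ^ j)).ofReal.mul_const (c k)
      simpa using h2
  · filter_upwards [eventually_ge_atTop 1] with τ hτ k
    refine (norm_poissonSeries_term_le hc j τ k).trans ?_
    gcongr

lemma norm_sub_le_of_norm_deriv_le_rpow {f f' : ℝ → ℂ} {A p : ℝ} (hp : p ≠ 0)
    (hf : ∀ s, 0 < s → HasDerivAt f (f' s) s) (hb : ∀ s, 0 < s → ‖f' s‖ ≤ A * s ^ (p - 1))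
    {a b : ℝ} (ha : 0 < a) (hab : a ≤ b) : ‖f b - f a‖ ≤ A / p * (b ^ p - a ^ p) := by
  have hB : ∀ x, 0 < x → HasDerivAt (fun x => A / p * (x ^ p - a ^ p)) (A * x ^ (p - 1)) x := by
    intro x hx
    refine (((Real.hasDerivAt_rpow_const (p := p) (Or.inl hx.ne')).sub_const (a ^ p)).const_mul
      (A / p)).congr_deriv ?_
    field_simp
  refine image_norm_le_of_norm_deriv_right_le_deriv_boundary' (f := fun x => f x - f a) (f' := f')
    (a := a) (b := b)
    (fun x hx => ((hf x (ha.trans_le hx.1)).sub_const _).continuousAt.continuousWithinAt)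
    (fun x hx => ((hf x (ha.trans_le hx.1)).sub_const _).hasDerivWithinAt) (by simp)
    (fun x hx => (hB x (ha.trans_le hx.1)).continuousAt.continuousWithinAt)
    (fun x hx => (hB x (ha.trans_le hx.1)).hasDerivWithinAt)
    (fun x hx => hb x (ha.trans_le hx.1)) ⟨hab, le_rfl⟩

lemma norm_le_of_norm_deriv_le_rpow {f f' : ℝ → ℂ} {A p : ℝ} (hp : p < 0)
    (hf : ∀ s, 0 < s → HasDerivAt f (f' s) s) (hb : ∀ s, 0 < s → ‖f' s‖ ≤ A * s ^ (p - 1))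
    (hlim : Tendsto f atTop (𝓝 0)) {a : ℝ} (ha : 0 < a) : ‖f a‖ ≤ A / (-p) * a ^ p := by
  have h1 : Tendsto (fun b => ‖f b - f a‖) atTop (𝓝 ‖0 - f a‖) := (hlim.sub_const _).norm
  have h2 : Tendsto (fun b : ℝ => A / p * (b ^ p - a ^ p)) atTop (𝓝 (A / p * (0 - a ^ p))) := by
    have := tendsto_rpow_neg_atTop (neg_pos.2 hp)
    rw [neg_neg] at this
    exact (this.sub_const _).const_mul _
  have h3 := le_of_tendsto_of_tendsto h1 h2 <| by
    filter_upwards [eventually_ge_atTop a] with b hab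
    exact norm_sub_le_of_norm_deriv_le_rpow hp.ne hf hb ha hab
  rw [zero_sub, norm_neg] at h3
  refine h3.trans_eq ?_
  rw [div_neg]; ring

lemma exists_bound_poissonSeries_one {κ : ℝ} (hκ : κ < 1) (j : ℕ) (C : ℝ) :
    ∃ C₁ : ℝ, ∀ (c : ℤ → ℂ) (A : ℝ), (∀ k, ‖c k‖ ≤ A) →
      (∀ τ, 0 < τ → ‖poissonSeries c (j + 1) τ‖ ≤ C * τ ^ (κ - ((j + 1 : ℕ) : ℝ))) →
      ∀ τ, 0 < τ → ‖poissonSeries c 1 τ‖ ≤ C₁ * τ ^ (κ - 1) := by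
  induction j generalizing C with
  | zero => exact ⟨C, fun c A _ h => by simpa using h⟩
  | succ j ih =>
    obtain ⟨C₁, h₁⟩ := ih (C / (-(κ - ((j + 1 : ℕ) : ℝ))))
    refine ⟨C₁, fun c A hc h => h₁ c A hc fun τ hτ => ?_⟩
    refine norm_le_of_norm_deriv_le_rpow ?_ (fun s hs => hasDerivAt_poissonSeries hc (j + 1) hs)
      (fun s hs => ?_) (tendsto_poissonSeries_atTop hc (Or.inl j.succ_ne_zero)) hτ
    · push_cast; linarith [j.cast_nonneg (α := ℝ)]
    · convert h s hs using 3
      push_cast; ring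

/-- The Poisson kernel of the circle, in closed form. -/
noncomputable def circlePoissonKernel (τ : ℝ) (x : AddCircle (1:ℝ)) : ℝ :=
  (1 - Real.exp (-(2 * π * τ)) ^ 2) / ‖1 - (Real.exp (-(2 * π * τ)) : ℂ) * fourier 1 x‖ ^ 2

lemma norm_fourier_apply (k : ℤ) (x : AddCircle (1:ℝ)) : ‖fourier k x‖ = 1 := by
  rw [fourier_apply, Circle.norm_coe]

lemma fourier_sub_apply (k : ℤ) (t x : AddCircle (1:ℝ)) :
    fourier k (t - x) = fourier k t * fourier (-k) x := by
  simp [fourier_apply, sub_eq_add_neg, smul_add, toCircle_add]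

lemma exp_neg_two_pi_mul_lt_one {τ : ℝ} (hτ : 0 < τ) : Real.exp (-(2 * π * τ)) < 1 := by
  rw [Real.exp_lt_one_iff]
  have : 0 < 2 * π * τ := by positivity
  linarith

lemma one_sub_exp_le_norm (τ : ℝ) (x : AddCircle (1:ℝ)) :
    1 - Real.exp (-(2 * π * τ)) ≤ ‖1 - (Real.exp (-(2 * π * τ)) : ℂ) * fourier 1 x‖ := by
  have h := norm_sub_norm_le (1 : ℂ) ((Real.exp (-(2 * π * τ)) : ℂ) * fourier 1 x)
  rwa [norm_one, norm_mul, norm_fourier_apply, mul_one, Complex.norm_real,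
    Real.norm_of_nonneg (Real.exp_pos _).le] at h

lemma norm_one_sub_exp_mul_fourier_pos {τ : ℝ} (hτ : 0 < τ) (x : AddCircle (1:ℝ)) :
    0 < ‖1 - (Real.exp (-(2 * π * τ)) : ℂ) * fourier 1 x‖ :=
  (sub_pos.2 (exp_neg_two_pi_mul_lt_one hτ)).trans_le (one_sub_exp_le_norm τ x)

lemma circlePoissonKernel_nonneg {τ : ℝ} (hτ : 0 < τ) (x : AddCircle (1:ℝ)) :
    0 ≤ circlePoissonKernel τ x := by
  have h := exp_neg_two_pi_mul_lt_one hτ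
  have h' := Real.exp_pos (-(2 * π * τ))
  exact div_nonneg (by nlinarith) (by positivity)

lemma continuous_circlePoissonKernel {τ : ℝ} (hτ : 0 < τ) :
    Continuous (circlePoissonKernel τ) := by
  unfold circlePoissonKernel
  refine Continuous.div (by fun_prop) (by fun_prop) fun x => ?_
  exact pow_ne_zero _ (norm_one_sub_exp_mul_fourier_pos hτ x).ne'

lemma hasSum_pow_natAbs_mul_zpow {r : ℝ} (hr0 : 0 ≤ r) (hr : r < 1) {w : ℂ} (hw : ‖w‖ = 1) :
    HasSum (fun k : ℤ => (r : ℂ) ^ k.natAbs * w ^ k)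
      (((1 - r ^ 2) / ‖1 - (r : ℂ) * w‖ ^ 2 : ℝ) : ℂ) := by
  have hz : ‖(r : ℂ) * w‖ = r := by
    rw [norm_mul, hw, mul_one, Complex.norm_real, Real.norm_of_nonneg hr0]
  have hwinv : w⁻¹ = conj w := Complex.inv_eq_conj hw
  have hcz : conj ((r : ℂ) * w) = r * w⁻¹ := by rw [map_mul, Complex.conj_ofReal, hwinv]
  have h1 : HasSum (fun n : ℕ => ((r : ℂ) * w) ^ n) (1 - (r : ℂ) * w)⁻¹ :=
    hasSum_geometric_of_norm_lt_one (by rwa [hz])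
  have h2 : HasSum (fun n : ℕ => conj ((r : ℂ) * w) * conj ((r : ℂ) * w) ^ n)
      (conj ((r : ℂ) * w) * (1 - conj ((r : ℂ) * w))⁻¹) :=
    HasSum.mul_left _ (hasSum_geometric_of_norm_lt_one (ξ := conj ((r : ℂ) * w))
      (by rwa [RCLike.norm_conj, hz]))
  have hne : 1 - (r : ℂ) * w ≠ 0 := by
    intro h
    rw [← sub_eq_zero.1 h, norm_one] at hz
    exact hr.ne' hz
  have hne' : 1 - conj ((r : ℂ) * w) ≠ 0 := by
    rw [← map_one conj, ← map_sub]
    exact (map_ne_zero _).2 hne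
  have hval : (((1 - r ^ 2) / ‖1 - (r : ℂ) * w‖ ^ 2 : ℝ) : ℂ) =
      (1 - (r : ℂ) * w)⁻¹ + conj ((r : ℂ) * w) * (1 - conj ((r : ℂ) * w))⁻¹ := by
    have e1 : ((‖1 - (r : ℂ) * w‖ ^ 2 : ℝ) : ℂ) =
        (1 - (r : ℂ) * w) * (1 - conj ((r : ℂ) * w)) := by
      rw [Complex.ofReal_pow, ← Complex.mul_conj', map_sub, map_one]
    have e2 : ((r ^ 2 : ℝ) : ℂ) = (r : ℂ) * w * conj ((r : ℂ) * w) := by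
      rw [Complex.mul_conj', hz, Complex.ofReal_pow]
    rw [Complex.ofReal_div, e1, Complex.ofReal_sub, e2, Complex.ofReal_one]
    generalize conj ((r : ℂ) * w) = z' at *
    generalize (r : ℂ) * w = z at *
    field_simp
    ring
  rw [hval]
  have h1' : HasSum (fun n : ℕ => (r : ℂ) ^ (n : ℤ).natAbs * w ^ (n : ℤ))
      (1 - (r : ℂ) * w)⁻¹ := by
    simpa only [Int.natAbs_natCast, zpow_natCast, mul_pow] using h1
  have h2' : HasSum (fun n : ℕ => (r : ℂ) ^ (-((n : ℤ) + 1)).natAbs * w ^ (-((n : ℤ) + 1)))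
      (conj ((r : ℂ) * w) * (1 - conj ((r : ℂ) * w))⁻¹) := by
    refine h2.congr_fun fun n => ?_
    rw [hcz, ← pow_succ', mul_pow, inv_pow, zpow_neg, Int.natAbs_neg]
    norm_cast
  exact h1'.of_nat_of_neg_add_one (f := fun k : ℤ => (r : ℂ) ^ k.natAbs * w ^ k) h2'

lemma hasSum_circlePoissonKernel {τ : ℝ} (hτ : 0 < τ) (x : AddCircle (1:ℝ)) :
    HasSum (fun k : ℤ => (Real.exp (-(2 * π * τ * |(k:ℝ)|)) : ℂ) * fourier k x)
      (circlePoissonKernel τ x : ℂ) := by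
  unfold circlePoissonKernel
  convert hasSum_pow_natAbs_mul_zpow (Real.exp_pos _).le (exp_neg_two_pi_mul_lt_one hτ)
    (norm_fourier_apply 1 x) using 3 with k
  · rw [← Complex.ofReal_pow, ← Real.exp_nat_mul, Nat.cast_natAbs, Int.cast_abs]
    ring_nf
  · simp [fourier_apply, toCircle_zsmul]

lemma integrable_of_continuous {E : Type*} [NormedAddCommGroup E] {f : AddCircle (1:ℝ) → E}
    (hf : Continuous f) : Integrable f haarAddCircle :=
  hf.integrable_of_hasCompactSupport (HasCompactSupport.of_compactSpace f)

lemma norm_fourierCoeff_le {f : AddCircle (1:ℝ) → ℂ} {B : ℝ} (hB : ∀ x, ‖f x‖ ≤ B) (k : ℤ) :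
    ‖fourierCoeff f k‖ ≤ B := by
  have h := norm_integral_le_of_norm_le_const (μ := haarAddCircle)
    (f := fun t => fourier (-k) t • f t) (C := B)
    (.of_forall fun t => by rw [norm_smul, norm_fourier_apply, one_mul]; exact hB t)
  simpa [fourierCoeff] using h

lemma norm_fourierCoeff_mul_fourier_le {f : AddCircle (1:ℝ) → ℂ} {B : ℝ} (hB : ∀ x, ‖f x‖ ≤ B)
    (t : AddCircle (1:ℝ)) (k : ℤ) : ‖fourierCoeff f k * fourier k t‖ ≤ B := by
  rw [norm_mul, norm_fourier_apply, mul_one]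
  exact norm_fourierCoeff_le hB k

lemma exists_norm_le {f : AddCircle (1:ℝ) → ℂ} (hf : Continuous f) : ∃ B, ∀ x, ‖f x‖ ≤ B := by
  obtain ⟨x, -, hx⟩ := isCompact_univ.exists_isMaxOn univ_nonempty hf.norm.continuousOn
  exact ⟨‖f x‖, fun y => hx (mem_univ y)⟩

lemma summable_exp_neg_abs {τ : ℝ} (hτ : 0 < τ) :
    Summable fun k : ℤ => Real.exp (-(2 * π * τ * |(k:ℝ)|)) := by
  simpa using summable_abs_pow_mul_exp 0 hτ

/-- The Poisson extension is the convolution with the Poisson kernel. -/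
lemma poissonSeries_eq_integral {f : AddCircle (1:ℝ) → ℂ} (hf : Continuous f) {τ : ℝ}
    (hτ : 0 < τ) (t : AddCircle (1:ℝ)) :
    poissonSeries (fun k => fourierCoeff f k * fourier k t) 0 τ =
      ∫ x, f x * (circlePoissonKernel τ (t - x) : ℂ) ∂haarAddCircle := by
  have h := hasSum_integral_of_summable_integral_norm (μ := haarAddCircle (T := (1:ℝ)))
    (F := fun (k : ℤ) x => f x * ((Real.exp (-(2 * π * τ * |(k:ℝ)|)) : ℂ) * fourier k (t - x)))
    (fun k => integrable_of_continuous (by fun_prop)) (by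
      simp only [norm_mul, norm_fourier_apply, mul_one, Complex.norm_real, integral_mul_const]
      exact ((summable_exp_neg_abs hτ).norm).mul_left _)
  simp only [tsum_mul_left, (hasSum_circlePoissonKernel hτ _).tsum_eq] at h
  rw [← h.tsum_eq]
  unfold poissonSeries
  congr 1
  ext k
  rw [pow_zero, one_mul]
  simp only [fourierCoeff]
  rw [← integral_mul_const, ← integral_const_mul]
  congr 1
  ext x
  rw [fourier_sub_apply, smul_eq_mul]
  ring

lemma poissonSeries_fourier (n : ℤ) (τ : ℝ) (t : AddCircle (1:ℝ)) :
    poissonSeries (fun k => fourierCoeff (T := (1:ℝ)) (fourier n) k * fourier k t) 0 τ =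
      (Real.exp (-(2 * π * τ * |(n:ℝ)|)) : ℂ) * fourier n t := by
  rw [poissonSeries, tsum_eq_single n]
  · simp [fourierCoeff_fourier]
  · intro k hk
    simp [fourierCoeff_fourier, hk]

lemma integral_circlePoissonKernel {τ : ℝ} (hτ : 0 < τ) (t : AddCircle (1:ℝ)) :
    ∫ x, circlePoissonKernel τ (t - x) ∂haarAddCircle = 1 := by
  have h := poissonSeries_eq_integral (f := fourier 0) (by fun_prop) hτ t
  rw [poissonSeries_fourier] at h
  simp only [fourier_zero, one_mul, integral_complex_ofReal] at h
  simpa using h.symm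

lemma integrable_circlePoissonKernel {τ : ℝ} (hτ : 0 < τ) (t : AddCircle (1:ℝ)) :
    Integrable (fun x => circlePoissonKernel τ (t - x)) haarAddCircle :=
  integrable_of_continuous
    ((continuous_circlePoissonKernel hτ).comp (continuous_const.sub continuous_id))

lemma norm_poissonSeries_le {f : AddCircle (1:ℝ) → ℂ} (hf : Continuous f) {B : ℝ}
    (hB : ∀ x, ‖f x‖ ≤ B) {τ : ℝ} (hτ : 0 < τ) (t : AddCircle (1:ℝ)) :
    ‖poissonSeries (fun k => fourierCoeff f k * fourier k t) 0 τ‖ ≤ B := by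
  rw [poissonSeries_eq_integral hf hτ]
  refine (norm_integral_le_of_norm_le ((integrable_circlePoissonKernel hτ t).const_mul B)
    (.of_forall fun x => ?_)).trans_eq ?_
  · rw [norm_mul, Complex.norm_real, Real.norm_of_nonneg (circlePoissonKernel_nonneg hτ _)]
    exact mul_le_mul_of_nonneg_right (hB x) (circlePoissonKernel_nonneg hτ _)
  · rw [integral_const_mul, integral_circlePoissonKernel hτ, mul_one]

lemma norm_fourier_one_sub_le (t s : AddCircle (1:ℝ)) :
    ‖fourier 1 t - fourier 1 s‖ ≤ 2 * π * dist t s := by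
  have h1 : fourier 1 t - fourier 1 s = (fourier 1 (t - s) - 1) * fourier 1 s := by
    rw [fourier_sub_apply, sub_mul, mul_assoc, ← fourier_add]
    simp
  rw [h1, norm_mul, norm_fourier_apply, mul_one, dist_eq_norm]
  obtain ⟨x, hx⟩ := QuotientAddGroup.mk_surjective (t - s)
  rw [← hx]
  change ‖fourier 1 (x : AddCircle (1:ℝ)) - 1‖ ≤ 2 * π * ‖(x : UnitAddCircle)‖
  have h2 : (x : AddCircle (1:ℝ)) = ((x - round x : ℝ) : AddCircle (1:ℝ)) := by
    rw [AddCircle.coe_sub, eq_comm, sub_eq_self, AddCircle.coe_eq_zero_iff]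
    exact ⟨round x, by simp⟩
  rw [UnitAddCircle.norm_eq, h2, fourier_coe_apply]
  have h3 := Real.norm_exp_I_mul_ofReal_sub_one_le (x := 2 * π * (x - round x))
  rw [norm_mul, Real.norm_of_nonneg (by positivity : 0 ≤ 2 * π)] at h3
  rw [Real.norm_eq_abs] at h3
  convert h3 using 4
  push_cast; ring

lemma abs_circlePoissonKernel_sub_le {τ : ℝ} (hτ : 0 < τ) (x y : AddCircle (1:ℝ)) :
    |circlePoissonKernel τ x - circlePoissonKernel τ y| ≤
      dist x y / τ * (circlePoissonKernel τ x + circlePoissonKernel τ y) := by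
  have hr := exp_neg_two_pi_mul_lt_one hτ
  have hr0 := Real.exp_pos (-(2 * π * τ))
  have hpx := norm_one_sub_exp_mul_fourier_pos hτ x
  have hpy := norm_one_sub_exp_mul_fourier_pos hτ y
  have hlx := one_sub_exp_le_norm τ x
  have hly := one_sub_exp_le_norm τ y
  have hd := norm_fourier_one_sub_le x y
  have hτr : 2 * π * τ * Real.exp (-(2 * π * τ)) ≤ 1 - Real.exp (-(2 * π * τ)) := by
    have h1 := Real.add_one_le_exp (2 * π * τ)
    have h2 : Real.exp (2 * π * τ) * Real.exp (-(2 * π * τ)) = 1 := by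
      rw [← Real.exp_add, add_neg_cancel, Real.exp_zero]
    nlinarith
  have hab : |‖1 - (Real.exp (-(2 * π * τ)) : ℂ) * fourier 1 y‖ -
      ‖1 - (Real.exp (-(2 * π * τ)) : ℂ) * fourier 1 x‖| ≤
      Real.exp (-(2 * π * τ)) * (2 * π * dist x y) := by
    refine (abs_norm_sub_norm_le _ _).trans ?_
    rw [sub_sub_sub_cancel_left, ← mul_sub, norm_mul, Complex.norm_real,
      Real.norm_of_nonneg hr0.le]
    gcongr
  unfold circlePoissonKernel
  generalize Real.exp (-(2 * π * τ)) = r at *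
  generalize ‖1 - (r : ℂ) * fourier 1 x‖ = a at *
  generalize ‖1 - (r : ℂ) * fourier 1 y‖ = b at *
  have hd0 : 0 ≤ dist x y := dist_nonneg
  generalize dist x y = d at *
  have hc : 0 ≤ 1 - r ^ 2 := by nlinarith
  have key : |b - a| ≤ d / τ * (1 - r) := by
    refine hab.trans ?_
    rw [div_mul_eq_mul_div, le_div_iff₀ hτ]
    nlinarith
  have e : (1 - r ^ 2) / a ^ 2 - (1 - r ^ 2) / b ^ 2 =
      (1 - r ^ 2) * (b - a) * ((b + a) / (a ^ 2 * b ^ 2)) := by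
    field_simp; ring
  have e' : (1 - r ^ 2) / a ^ 2 + (1 - r ^ 2) / b ^ 2 =
      (1 - r ^ 2) * ((b ^ 2 + a ^ 2) / (a ^ 2 * b ^ 2)) := by
    field_simp
  rw [e, e', abs_mul, abs_mul, abs_of_nonneg hc,
    abs_of_nonneg (by positivity : 0 ≤ (b + a) / (a ^ 2 * b ^ 2))]
  calc (1 - r ^ 2) * |b - a| * ((b + a) / (a ^ 2 * b ^ 2))
      ≤ (1 - r ^ 2) * (d / τ * (1 - r)) * ((b + a) / (a ^ 2 * b ^ 2)) := by gcongr
    _ = (1 - r ^ 2) * (d / τ) * (((1 - r) * b + (1 - r) * a) / (a ^ 2 * b ^ 2)) := by ring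
    _ ≤ (1 - r ^ 2) * (d / τ) * ((b ^ 2 + a ^ 2) / (a ^ 2 * b ^ 2)) := by
        gcongr <;> nlinarith
    _ = _ := by ring

lemma norm_poissonSeries_sub_le {f : AddCircle (1:ℝ) → ℂ} (hf : Continuous f) {B : ℝ}
    (hB : ∀ x, ‖f x‖ ≤ B) {τ : ℝ} (hτ : 0 < τ) (t s : AddCircle (1:ℝ)) :
    ‖poissonSeries (fun k => fourierCoeff f k * fourier k t) 0 τ -
      poissonSeries (fun k => fourierCoeff f k * fourier k s) 0 τ‖ ≤ 2 * B * (dist t s / τ) := by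
  have hK : ∀ t : AddCircle (1:ℝ), Continuous fun x => circlePoissonKernel τ (t - x) :=
    fun t => (continuous_circlePoissonKernel hτ).comp (continuous_const.sub continuous_id)
  have hI : ∀ t : AddCircle (1:ℝ),
      Integrable (fun x => f x * (circlePoissonKernel τ (t - x) : ℂ)) haarAddCircle :=
    fun t => integrable_of_continuous (hf.mul (Complex.continuous_ofReal.comp (hK t)))
  have hB0 : 0 ≤ B := (norm_nonneg _).trans (hB 0)
  rw [poissonSeries_eq_integral hf hτ, poissonSeries_eq_integral hf hτ, 
    ← integral_sub (hI t) (hI s)]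
  refine (norm_integral_le_of_norm_le (((integrable_circlePoissonKernel hτ t).add
    (integrable_circlePoissonKernel hτ s)).const_mul (B * (dist t s / τ)))
    (.of_forall fun x => ?_)).trans_eq ?_
  · rw [← mul_sub, norm_mul, ← Complex.ofReal_sub, Complex.norm_real, Real.norm_eq_abs, mul_assoc]
    have h := abs_circlePoissonKernel_sub_le hτ (t - x) (s - x)
    rw [dist_sub_right] at h
    exact mul_le_mul (hB x) h (abs_nonneg _) hB0
  · simp only [Pi.add_apply]
    rw [integral_const_mul, integral_add (integrable_circlePoissonKernel hτ t)
      (integrable_circlePoissonKernel hτ s), integral_circlePoissonKernel hτ,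
      integral_circlePoissonKernel hτ]
    ring

lemma fourierCoeff_tsum_mul_fourier {c : ℤ → ℂ} (hc : Summable c) (n : ℤ) :
    fourierCoeff (fun x : AddCircle (1:ℝ) => ∑' k, c k * fourier k x) n = c n := by
  have h := hasSum_integral_of_summable_integral_norm (μ := haarAddCircle (T := (1:ℝ)))
    (F := fun (k : ℤ) x => fourier (-n) x * (c k * fourier k x))
    (fun k => integrable_of_continuous (by fun_prop)) (by
      simpa only [norm_mul, norm_fourier_apply, mul_one, one_mul, integral_const, probReal_univ,
        one_smul] using hc.norm)
  simp only [tsum_mul_left] at h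
  have h2 : ∀ k : ℤ, ∫ x : AddCircle (1:ℝ), fourier (-n) x * (c k * fourier k x) ∂haarAddCircle =
      c k * (Pi.single k 1 : ℤ → ℂ) n := by
    intro k
    rw [← fourierCoeff_fourier (T := (1:ℝ)) k, fourierCoeff, ← integral_const_mul]
    congr 1
    ext x
    rw [smul_eq_mul]
    ring
  simp only [fourierCoeff, smul_eq_mul]
  rw [← h.tsum_eq]
  simp only [h2]
  rw [tsum_eq_single n]
  · simp
  · intro k hk
    simp [hk.symm]

lemma continuous_poissonSeries {c : ℤ → ℂ} {A : ℝ} (hc : ∀ k, ‖c k‖ ≤ A) (j : ℕ) {τ : ℝ}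
    (hτ : 0 < τ) :
    Continuous fun x : AddCircle (1:ℝ) => poissonSeries (fun k => c k * fourier k x) j τ := by
  unfold poissonSeries
  refine continuous_tsum (fun k => by fun_prop)
    ((summable_abs_pow_mul_exp j hτ).mul_left (A * (2 * π) ^ j)) fun k x => ?_
  refine norm_poissonSeries_term_le (c := fun k => c k * fourier k x) (fun k => ?_) j τ k
  rw [norm_mul, norm_fourier_apply, mul_one]
  exact hc k

/-- The semigroup property of the Poisson extension. -/
lemma poissonSeries_eq_poissonSeries_half {c : ℤ → ℂ} {A : ℝ} (hc : ∀ k, ‖c k‖ ≤ A) (j : ℕ)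
    {τ : ℝ} (hτ : 0 < τ) (t : AddCircle (1:ℝ)) :
    poissonSeries (fun k => fourierCoeff (fun x : AddCircle (1:ℝ) =>
      poissonSeries (fun k => c k * fourier k x) j (τ / 2)) k * fourier k t) 0 (τ / 2) =
    poissonSeries (fun k => c k * fourier k t) j τ := by
  unfold poissonSeries
  congr 1
  ext k
  simp only [← mul_assoc]
  rw [fourierCoeff_tsum_mul_fourier (summable_poissonSeries hc j (half_pos hτ)), ← mul_assoc,
    ← Complex.ofReal_mul]
  congr 3
  rw [pow_zero, one_mul, mul_left_comm, ← Real.exp_add]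
  congr 2
  ring

lemma tendsto_poissonSeries_zero {φ : AddCircle (1:ℝ) → ℂ} (hφ : Continuous φ)
    (t : AddCircle (1:ℝ)) :
    Tendsto (fun τ => poissonSeries (fun k => fourierCoeff φ k * fourier k t) 0 τ) (𝓝[>] 0)
      (𝓝 (φ t)) := by
  have hspan : ∀ f ∈ Submodule.span ℂ (range (@fourier (1:ℝ))),
      Tendsto (fun τ => poissonSeries (fun k => fourierCoeff f k * fourier k t) 0 τ) (𝓝[>] 0)
        (𝓝 (f t)) := by
    intro f hf
    induction hf using Submodule.span_induction with
    | mem f hf =>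
      obtain ⟨n, rfl⟩ := hf
      simp only [poissonSeries_fourier]
      have h : Continuous fun τ : ℝ =>
          (Real.exp (-(2 * π * τ * |(n:ℝ)|)) : ℂ) * fourier n t := by fun_prop
      have h0 := (h.tendsto 0).mono_left (nhdsWithin_le_nhds (s := Ioi 0))
      simpa using h0
    | zero => simp [poissonSeries, fourierCoeff]
    | add f g _ _ hf hg =>
      refine (hf.add hg).congr' ?_
      filter_upwards [self_mem_nhdsWithin] with τ hτ
      obtain ⟨A, hA⟩ := exists_norm_le f.continuous
      obtain ⟨B, hB⟩ := exists_norm_le g.continuous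
      rw [poissonSeries, poissonSeries, poissonSeries, ← Summable.tsum_add
        (summable_poissonSeries (norm_fourierCoeff_mul_fourier_le hA t) 0 hτ)
        (summable_poissonSeries (norm_fourierCoeff_mul_fourier_le hB t) 0 hτ)]
      rw [ContinuousMap.coe_add, fourierCoeff.add (integrable_of_continuous f.continuous)
        (integrable_of_continuous g.continuous)]
      congr 1
      ext k
      rw [Pi.add_apply]
      ring
    | smul a f _ hf =>
      refine (hf.const_mul a).congr fun τ => ?_
      rw [poissonSeries, poissonSeries, ← tsum_mul_left]
      congr 1
      ext k
      rw [ContinuousMap.coe_smul, fourierCoeff.const_smul, smul_eq_mul]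
      ring
  rw [Metric.tendsto_nhds]
  intro ε hε
  have hmem : (⟨φ, hφ⟩ : C(AddCircle (1:ℝ), ℂ)) ∈
      closure (Submodule.span ℂ (range (@fourier (1:ℝ))) : Set C(AddCircle (1:ℝ), ℂ)) := by
    rw [← Submodule.topologicalClosure_coe, span_fourier_closure_eq_top]
    trivial
  obtain ⟨p, hp, hdist⟩ := Metric.mem_closure_iff.1 hmem (ε / 3) (by positivity)
  have hpφ : ∀ x, ‖φ x - p x‖ ≤ ε / 3 := fun x => by
    rw [← dist_eq_norm]
    exact (ContinuousMap.dist_apply_le_dist (f := ⟨φ, hφ⟩) x).trans hdist.le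
  have hcont : Continuous fun x => φ x - p x := hφ.sub p.continuous
  filter_upwards [self_mem_nhdsWithin, Metric.tendsto_nhds.1 (hspan p hp) (ε / 3) (by positivity)]
    with τ hτ hpτ
  have hsub : poissonSeries (fun k => fourierCoeff φ k * fourier k t) 0 τ -
      poissonSeries (fun k => fourierCoeff p k * fourier k t) 0 τ =
      poissonSeries (fun k => fourierCoeff (fun x => φ x - p x) k * fourier k t) 0 τ := by
    rw [poissonSeries_eq_integral hφ hτ, poissonSeries_eq_integral p.continuous hτ,
      poissonSeries_eq_integral hcont hτ, ← integral_sub]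
    · simp only [sub_mul]
    all_goals
      refine integrable_of_continuous (Continuous.mul (by fun_prop) ?_)
      exact Complex.continuous_ofReal.comp
        ((continuous_circlePoissonKernel hτ).comp (continuous_const.sub continuous_id))
  have h1 := norm_poissonSeries_le hcont hpφ hτ t
  rw [← hsub, ← dist_eq_norm] at h1
  have h2 : dist (p t) (φ t) ≤ ε / 3 := by
    rw [dist_comm, dist_eq_norm]
    exact hpφ t
  calc dist (poissonSeries (fun k => fourierCoeff φ k * fourier k t) 0 τ) (φ t)
      ≤ _ := dist_triangle4 _ _ _ _
    _ < ε / 3 + ε / 3 + ε / 3 := add_lt_add_of_lt_of_le (add_lt_add_of_le_of_lt h1 hpτ) h2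
    _ = ε := by ring

lemma norm_sub_poissonSeries_le {φ : AddCircle (1:ℝ) → ℂ} (hφ : Continuous φ) {κ C : ℝ}
    (hκ : 0 < κ) {t : AddCircle (1:ℝ)}
    (h : ∀ τ, 0 < τ →
      ‖poissonSeries (fun k => fourierCoeff φ k * fourier k t) 1 τ‖ ≤ C * τ ^ (κ - 1))
    {τ : ℝ} (hτ : 0 < τ) :
    ‖poissonSeries (fun k => fourierCoeff φ k * fourier k t) 0 τ - φ t‖ ≤ C / κ * τ ^ κ := by
  obtain ⟨A, hA⟩ := exists_norm_le hφ
  have h1 := ((tendsto_poissonSeries_zero hφ t).const_sub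
    (poissonSeries (fun k => fourierCoeff φ k * fourier k t) 0 τ)).norm
  have h2 : Tendsto (fun s : ℝ => C / κ * (τ ^ κ - s ^ κ)) (𝓝[>] 0)
      (𝓝 (C / κ * (τ ^ κ - 0 ^ κ))) :=
    (((Real.continuousAt_rpow_const 0 κ (Or.inr hκ.le)).tendsto.mono_left
      nhdsWithin_le_nhds).const_sub _).const_mul _
  rw [Real.zero_rpow hκ.ne', sub_zero] at h2
  refine le_of_tendsto_of_tendsto h1 h2 ?_
  filter_upwards [Ioo_mem_nhdsGT hτ] with s hs
  exact norm_sub_le_of_norm_deriv_le_rpow hκ.ne'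
    (fun s hs => hasDerivAt_poissonSeries (norm_fourierCoeff_mul_fourier_le hA t) 0 hs) h hs.1
    hs.2.le

lemma norm_poissonSeries_sub_le_rpow {φ : AddCircle (1:ℝ) → ℂ} (hφ : Continuous φ) {κ C : ℝ}
    (hκ : κ < 1)
    (h : ∀ (t : AddCircle (1:ℝ)) τ, 0 < τ →
      ‖poissonSeries (fun k => fourierCoeff φ k * fourier k t) 1 τ‖ ≤ C * τ ^ (κ - 1))
    (t s : AddCircle (1:ℝ)) {τ : ℝ} (hτ : 0 < τ) :
    ‖poissonSeries (fun k => fourierCoeff φ k * fourier k t) 0 τ -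
      poissonSeries (fun k => fourierCoeff φ k * fourier k s) 0 τ‖ ≤
      4 * C * 2⁻¹ ^ (κ - 1) * dist t s / (1 - κ) * τ ^ (κ - 1) := by
  obtain ⟨A, hA⟩ := exists_norm_le hφ
  have hsub : ∀ j τ, 0 < τ → poissonSeries (fun k => fourierCoeff φ k * fourier k t) j τ -
      poissonSeries (fun k => fourierCoeff φ k * fourier k s) j τ =
      poissonSeries (fun k => fourierCoeff φ k * fourier k t -
        fourierCoeff φ k * fourier k s) j τ := by
    intro j τ hτ
    rw [poissonSeries, poissonSeries, poissonSeries, ← Summable.tsum_sub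
      (summable_poissonSeries (norm_fourierCoeff_mul_fourier_le hA t) j hτ)
      (summable_poissonSeries (norm_fourierCoeff_mul_fourier_le hA s) j hτ)]
    simp only [mul_sub]
  have hc : ∀ k, ‖fourierCoeff φ k * fourier k t - fourierCoeff φ k * fourier k s‖ ≤ A + A :=
    fun k => (norm_sub_le _ _).trans (add_le_add (norm_fourierCoeff_mul_fourier_le hA t k)
      (norm_fourierCoeff_mul_fourier_le hA s k))
  rw [hsub 0 τ hτ, ← neg_sub κ 1]
  refine norm_le_of_norm_deriv_le_rpow (sub_neg.2 hκ)
    (fun s hs => hasDerivAt_poissonSeries hc 0 hs) (fun σ hσ => ?_)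
    (tendsto_poissonSeries_atTop hc (Or.inr (by simp))) hτ
  rw [zero_add, ← hsub 1 σ hσ,
    ← poissonSeries_eq_poissonSeries_half (norm_fourierCoeff_le hA) 1 hσ t,
    ← poissonSeries_eq_poissonSeries_half (norm_fourierCoeff_le hA) 1 hσ s]
  refine (norm_poissonSeries_sub_le (continuous_poissonSeries (norm_fourierCoeff_le hA) 1
    (half_pos hσ)) (fun x => h x _ (half_pos hσ)) (half_pos hσ) t s).trans_eq ?_
  rw [Real.rpow_sub_one hσ.ne', div_eq_mul_inv σ 2, Real.mul_rpow hσ.le (by norm_num)]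
  field_simp
  ring

/-- Continuous Littlewood–Paley criterion (sufficiency): if the `η`-th
`τ`-derivative of the Poisson-type extension `e^{−τ√(−Δ)} φ` has sup norm
`≤ C τ^{κ−η}` for all `τ > 0`, then `φ` is `κ`-Hölder. -/
theorem stmt9 (φ : AddCircle (1:ℝ) → ℂ) (hφ : Continuous φ)
    (κ : ℝ) (hκ : κ ∈ Set.Ioo (0:ℝ) 1)
    (η : ℕ) (hη : 1 ≤ η) (C : ℝ) (hC : 0 < C)
    (hbound : ∀ τ : ℝ, 0 < τ → ∀ t : AddCircle (1:ℝ),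
      ‖∑' k : ℤ, (((-(2 * Real.pi * |(k:ℝ)|))^η * Real.exp (-(2 * Real.pi * τ * |(k:ℝ)|)) : ℝ) : ℂ)
          * fourierCoeff φ k * fourier k t‖ ≤ C * τ ^ (κ - (η:ℝ))) :
    ∃ C' : ℝ, 0 < C' ∧ ∀ t s : AddCircle (1:ℝ), ‖φ t - φ s‖ ≤ C' * dist t s ^ κ := by
  obtain ⟨hκ0, hκ1⟩ := hκ
  obtain ⟨A, hA⟩ := exists_norm_le hφ
  obtain ⟨j, rfl⟩ := Nat.exists_eq_add_of_le' hη
  obtain ⟨C₁, hC₁⟩ := exists_bound_poissonSeries_one hκ1 j C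
  have h1 : ∀ t τ, 0 < τ →
      ‖poissonSeries (fun k => fourierCoeff φ k * fourier k t) 1 τ‖ ≤ C₁ * τ ^ (κ - 1) :=
    fun t => hC₁ _ A (norm_fourierCoeff_mul_fourier_le hA t) fun τ hτ => by
      simpa only [poissonSeries, mul_assoc] using hbound τ hτ t
  set K := C₁ / κ + 4 * C₁ * 2⁻¹ ^ (κ - 1) / (1 - κ) + C₁ / κ with hK
  refine ⟨max K 1, by positivity, fun t s => ?_⟩
  rcases eq_or_ne t s with rfl | hts
  · simp [Real.zero_rpow hκ0.ne']
  have hd : 0 < dist t s := dist_pos.2 hts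
  have ht := norm_sub_poissonSeries_le hφ hκ0 (h1 t) hd
  have hs := norm_sub_poissonSeries_le hφ hκ0 (h1 s) hd
  have hm := norm_poissonSeries_sub_le_rpow hφ hκ1 h1 t s hd
  rw [← dist_eq_norm] at ht hs hm ⊢
  rw [dist_comm] at ht
  calc dist (φ t) (φ s) ≤ _ := dist_triangle4 _ _ _ _
    _ ≤ _ := add_le_add (add_le_add ht hm) hs
    _ = K * dist t s ^ κ := by
      rw [Real.rpow_sub_one hd.ne', hK]
      field_simp
    _ ≤ max K 1 * dist t s ^ κ := by gcongr; exact le_max_left _ _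
end

section
/- Conversely, if φ : ℝ/ℤ → ℂ is κ-Hölder with κ ∈ (0,1), then for every integer η ≥ 1 there is C > 0 such that ‖(∂/∂τ)^η e^{−τ√(−Δ)} φ‖_∞ ≤ C τ^{κ−η} for all τ ∈ (0,1]. -/
open Complex Real Set

/-- The power series `∑ k ^ η * choose (k + j) j * z ^ k` converges in the unit disc and is
bounded there by a multiple of `‖1 - z‖⁻¹ ^ (η + j + 1)`. -/
lemma exists_norm_tsum_pow_mul_choose_mul_geometric_le (η : ℕ) : ∀ j : ℕ, ∃ C : ℝ, 0 < C ∧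
    ∀ z : ℂ, ‖z‖ < 1 →
      Summable (fun k : ℕ => (k : ℂ) ^ η * ((k + j).choose j : ℂ) * z ^ k) ∧
      ‖∑' k : ℕ, (k : ℂ) ^ η * ((k + j).choose j : ℂ) * z ^ k‖ ≤ C / ‖1 - z‖ ^ (η + j + 1) := by
  induction η with
  | zero =>
    refine fun j => ⟨1, one_pos, fun z hz => ?_⟩
    have h := hasSum_choose_mul_geometric_of_norm_lt_one j hz
    simp only [pow_zero, one_mul, zero_add]
    refine ⟨h.summable, ?_⟩
    rw [h.tsum_eq, norm_div, norm_pow, norm_one]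
  | succ η ih =>
    intro j
    obtain ⟨C₁, hC₁, h₁⟩ := ih (j + 1)
    obtain ⟨C₂, hC₂, h₂⟩ := ih j
    refine ⟨(j + 1) * (C₁ + 2 * C₂), by positivity, fun z hz => ?_⟩
    obtain ⟨s₁, b₁⟩ := h₁ z hz
    obtain ⟨s₂, b₂⟩ := h₂ z hz
    have key : ∀ k : ℕ, (k : ℂ) ^ (η + 1) * ((k + j).choose j : ℂ) * z ^ k =
        (j + 1 : ℂ) * ((k : ℂ) ^ η * ((k + (j + 1)).choose (j + 1) : ℂ) * z ^ k -
          (k : ℂ) ^ η * ((k + j).choose j : ℂ) * z ^ k) := by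
      intro k
      have h : ((k : ℂ) + j + 1) * ((k + j).choose j : ℂ) =
          ((k + (j + 1)).choose (j + 1) : ℂ) * (j + 1) := by
        exact_mod_cast Nat.add_one_mul_choose_eq (k + j) j
      linear_combination ((k : ℂ) ^ η * z ^ k) * h
    simp only [key]
    refine ⟨(s₁.sub s₂).mul_left _, ?_⟩
    have hne : 1 - z ≠ 0 := by
      rw [sub_ne_zero]
      rintro rfl
      simp at hz
    have hpos : 0 < ‖1 - z‖ := norm_pos_iff.2 hne
    have hle : ‖1 - z‖ ≤ 2 := by
      calc ‖1 - z‖ ≤ ‖(1 : ℂ)‖ + ‖z‖ := norm_sub_le _ _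
        _ ≤ 2 := by rw [norm_one]; linarith
    have hC : C₂ / ‖1 - z‖ ^ (η + j + 1) ≤ 2 * C₂ / ‖1 - z‖ ^ (η + 1 + j + 1) := by
      rw [div_le_div_iff₀ (by positivity) (by positivity),
        show η + 1 + j + 1 = (η + j + 1) + 1 by ring, pow_succ]
      have : 0 ≤ C₂ * ‖1 - z‖ ^ (η + j + 1) := by positivity
      nlinarith
    rw [tsum_mul_left, s₁.tsum_sub s₂, norm_mul]
    have hj : ‖(j + 1 : ℂ)‖ = j + 1 := by exact_mod_cast Complex.norm_natCast (j + 1)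
    rw [hj, mul_div_assoc]
    gcongr
    refine (norm_sub_le _ _).trans ?_
    rw [add_div]
    exact add_le_add (by simpa only [add_assoc, add_comm, add_left_comm] using b₁) (b₂.trans hC)

lemma add_abs_le_norm_one_sub_exp {τ x : ℝ} (hτ : τ ∈ Set.Ioc (0 : ℝ) 1) (hx : |x| ≤ 1 / 2) :
    Real.exp (-(2 * Real.pi)) / 2 * (τ + |x|) ≤
      ‖1 - Complex.exp ((-(2 * Real.pi * τ) : ℝ) + (2 * Real.pi * x : ℝ) * I)‖ := by
  set c := Real.exp (-(2 * Real.pi)) with hc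
  set r := Real.exp (-(2 * Real.pi * τ)) with hr
  have hπ := Real.pi_gt_three
  have hc0 : 0 < c := Real.exp_pos _
  have hc1 : c ≤ 1 := Real.exp_le_one_iff.2 (by linarith)
  have hcr : c ≤ r := Real.exp_le_exp.2 (by nlinarith [hτ.2])
  have h1r : c * τ ≤ 1 - r := by
    have h := Real.add_one_le_exp (2 * Real.pi * τ)
    have hmul : r * Real.exp (2 * Real.pi * τ) = 1 := by
      rw [hr, ← Real.exp_add]; simp
    have hr0 : 0 < r := Real.exp_pos _
    nlinarith [hτ.1, mul_le_mul_of_nonneg_right hcr hτ.1.le, mul_pos hr0 hτ.1]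
  have hsin : 2 * |x| ≤ |Real.sin (Real.pi * x)| := by
    have h := Real.mul_abs_le_abs_sin (x := Real.pi * x)
      (by rw [abs_mul, abs_of_pos Real.pi_pos]; nlinarith)
    rw [abs_mul, abs_of_pos Real.pi_pos] at h
    convert h using 1
    field_simp
  have hcos : Real.cos (2 * Real.pi * x) = 1 - 2 * Real.sin (Real.pi * x) ^ 2 := by
    rw [show 2 * Real.pi * x = 2 * (Real.pi * x) by ring, Real.cos_two_mul, Real.cos_sq']
    ring
  have hnorm : ‖1 - Complex.exp ((-(2 * Real.pi * τ) : ℝ) + (2 * Real.pi * x : ℝ) * I)‖ ^ 2 =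
      (1 - r) ^ 2 + 4 * r * Real.sin (Real.pi * x) ^ 2 := by
    rw [← Complex.normSq_eq_norm_sq, Complex.normSq_apply]
    have hre : (Complex.exp ((-(2 * Real.pi * τ) : ℝ) + (2 * Real.pi * x : ℝ) * I)).re =
        r * Real.cos (2 * Real.pi * x) := by
      rw [Complex.exp_re]
      simp only [add_re, add_im, ofReal_re, ofReal_im, re_ofReal_mul, im_ofReal_mul, I_re, I_im,
        mul_zero, mul_one, add_zero, zero_add, hr]
    have him : (Complex.exp ((-(2 * Real.pi * τ) : ℝ) + (2 * Real.pi * x : ℝ) * I)).im =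
        r * Real.sin (2 * Real.pi * x) := by
      rw [Complex.exp_im]
      simp only [add_re, add_im, ofReal_re, ofReal_im, re_ofReal_mul, im_ofReal_mul, I_re, I_im,
        mul_zero, mul_one, add_zero, zero_add, hr]
    rw [sub_re, sub_im, hre, him, one_re, one_im]
    linear_combination r ^ 2 * Real.sin_sq_add_cos_sq (2 * Real.pi * x) - 2 * r * hcos
  refine le_of_sq_le_sq ?_ (norm_nonneg _)
  rw [hnorm]
  have hs2 : (2 * |x|) ^ 2 ≤ Real.sin (Real.pi * x) ^ 2 := by
    rw [← sq_abs (Real.sin _)]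
    gcongr
  have hx0 := abs_nonneg x
  calc (c / 2 * (τ + |x|)) ^ 2 ≤ (c * τ) ^ 2 + 4 * c ^ 2 * (2 * |x|) ^ 2 := by
        have : 0 ≤ c ^ 2 * ((τ - |x|) ^ 2 + |x| ^ 2 + τ ^ 2) := by positivity
        nlinarith [mul_nonneg (sq_nonneg c) (sq_nonneg |x|)]
    _ ≤ (1 - r) ^ 2 + 4 * r * Real.sin (Real.pi * x) ^ 2 := by
        have := hτ.1
        have h2 : c ^ 2 ≤ r := by nlinarith
        have h3 : 0 ≤ r := hc0.le.trans hcr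
        gcongr

/-- The Fourier multiplier of the `η`-th `τ`-derivative of the Poisson semigroup. -/
noncomputable def poissonMultiplier (η : ℕ) (τ : ℝ) (k : ℤ) : ℝ :=
  (-(2 * Real.pi * |(k : ℝ)|)) ^ η * Real.exp (-(2 * Real.pi * τ * |(k : ℝ)|))

lemma poissonMultiplier_neg (η : ℕ) (τ : ℝ) (k : ℤ) :
    poissonMultiplier η τ (-k) = poissonMultiplier η τ k := by
  simp [poissonMultiplier]

lemma poissonMultiplier_zero {η : ℕ} (hη : 1 ≤ η) (τ : ℝ) : poissonMultiplier η τ 0 = 0 := by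
  simp [poissonMultiplier, Nat.one_le_iff_ne_zero.1 hη]

lemma poissonMultiplier_mul_fourier_natCast (η : ℕ) (τ x : ℝ) (k : ℕ) :
    (poissonMultiplier η τ k : ℂ) * fourier (k : ℤ) (x : AddCircle (1 : ℝ)) =
      (-(2 * Real.pi)) ^ η * ((k : ℂ) ^ η * ((k + 0).choose 0 : ℂ) *
        Complex.exp ((-(2 * Real.pi * τ) : ℝ) + (2 * Real.pi * x : ℝ) * I) ^ k) := by
  rw [fourier_coe_apply, ← Complex.exp_nat_mul, poissonMultiplier]
  push_cast
  rw [show (k : ℂ) * (-(2 * Real.pi * τ) + 2 * Real.pi * x * I) =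
      -(2 * Real.pi * τ * k) + 2 * Real.pi * I * k * x / 1 by ring, Complex.exp_add]
  simp only [Nat.abs_cast, Nat.choose_zero_right, Nat.cast_one, mul_one, Complex.ofReal_natCast]
  rw [show -(2 * (Real.pi : ℂ) * k) = -(2 * Real.pi) * k by ring, mul_pow]
  ring

lemma norm_exp_poisson_lt_one {τ : ℝ} (hτ : 0 < τ) (x : ℝ) :
    ‖Complex.exp ((-(2 * Real.pi * τ) : ℝ) + (2 * Real.pi * x : ℝ) * I)‖ < 1 := by
  rw [Complex.norm_exp, Real.exp_lt_one_iff]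
  simp only [add_re, ofReal_re, re_ofReal_mul, I_re, mul_zero, add_zero]
  have := Real.pi_pos
  have : 0 < 2 * Real.pi * τ := by positivity
  linarith

/-- The kernel of the `η`-th `τ`-derivative of the Poisson semigroup is bounded by a multiple of
`(τ + ‖u‖)⁻¹ ^ (η + 1)`. -/
lemma exists_norm_tsum_poissonMultiplier_le {η : ℕ} (hη : 1 ≤ η) : ∃ C : ℝ, 0 < C ∧
    ∀ τ ∈ Set.Ioc (0 : ℝ) 1, ∀ u : AddCircle (1 : ℝ),
      Summable (fun k : ℤ => (poissonMultiplier η τ k : ℂ) * fourier k u) ∧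
      ‖∑' k : ℤ, (poissonMultiplier η τ k : ℂ) * fourier k u‖ ≤ C / (τ + ‖u‖) ^ (η + 1) := by
  obtain ⟨C, hC, h⟩ := exists_norm_tsum_pow_mul_choose_mul_geometric_le η 0
  set c := Real.exp (-(2 * Real.pi)) / 2 with hc
  have hc0 : 0 < c := by positivity
  refine ⟨2 * ((2 * Real.pi) ^ η * (C / c ^ (η + 1))), by positivity, fun τ hτ u => ?_⟩
  obtain ⟨x, hx, rfl⟩ : ∃ x : ℝ, |x| ≤ 1 / 2 ∧ (x : AddCircle (1 : ℝ)) = u := by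
    induction u using QuotientAddGroup.induction_on with
    | H y =>
      refine ⟨y - round y, abs_sub_round y, ?_⟩
      have h : ((round y : ℝ) : AddCircle (1 : ℝ)) = 0 :=
        (AddCircle.coe_eq_zero_iff 1).2 ⟨round y, by simp⟩
      rw [AddCircle.coe_sub, h]
      exact sub_zero _
  have hnx : ‖(x : AddCircle (1 : ℝ))‖ = |x| :=
    (AddCircle.norm_coe_eq_abs_iff 1 one_ne_zero).2 (by simpa using hx)
  rw [hnx]
  have half : ∀ y : ℝ, |y| = |x| →
      Summable (fun k : ℕ => (poissonMultiplier η τ k : ℂ) *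
        fourier (k : ℤ) (y : AddCircle (1 : ℝ))) ∧
      ‖∑' k : ℕ, (poissonMultiplier η τ k : ℂ) * fourier (k : ℤ) (y : AddCircle (1 : ℝ))‖ ≤
        (2 * Real.pi) ^ η * (C / c ^ (η + 1)) / (τ + |x|) ^ (η + 1) := by
    intro y hy
    simp only [poissonMultiplier_mul_fourier_natCast]
    obtain ⟨s, b⟩ := h _ (norm_exp_poisson_lt_one hτ.1 y)
    refine ⟨s.mul_left _, ?_⟩
    have hlow := add_abs_le_norm_one_sub_exp hτ (hy.trans_le hx)
    rw [hy, ← hc] at hlow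
    have hpos : 0 < τ + |x| := add_pos_of_pos_of_nonneg hτ.1 (abs_nonneg x)
    have hπ : ‖(-(2 * Real.pi) : ℂ)‖ = 2 * Real.pi := by
      simp [abs_of_pos Real.pi_pos]
    rw [tsum_mul_left, norm_mul, norm_pow, hπ, mul_div_assoc, div_div, ← mul_pow]
    gcongr
    refine b.trans ?_
    rw [add_zero]
    gcongr
  obtain ⟨s₁, b₁⟩ := half x rfl
  obtain ⟨s₂, b₂⟩ := half (-x) (abs_neg x)
  have hneg : ∀ k : ℕ, (poissonMultiplier η τ k : ℂ) *
      fourier (k : ℤ) ((-x : ℝ) : AddCircle (1 : ℝ)) =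
      (poissonMultiplier η τ (-k) : ℂ) * fourier (-k : ℤ) (x : AddCircle (1 : ℝ)) := by
    intro k
    rw [poissonMultiplier_neg]
    simp [fourier_apply]
  simp only [hneg] at s₂ b₂
  have hs := HasSum.of_nat_of_neg
    (f := fun k : ℤ => (poissonMultiplier η τ k : ℂ) * fourier k (x : AddCircle (1 : ℝ)))
    s₁.hasSum s₂.hasSum
  refine ⟨hs.summable, ?_⟩
  rw [hs.tsum_eq, poissonMultiplier_zero hη, ofReal_zero, zero_mul, sub_zero, mul_div_assoc,
    two_mul]
  exact (norm_add_le _ _).trans (add_le_add b₁ b₂)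

/-- The `η`-th `τ`-derivative of the Poisson semigroup as an integral of increments against
the kernel. -/
lemma tsum_poissonMultiplier_mul_fourierCoeff {φ : AddCircle (1 : ℝ) → ℂ} (hφ : Continuous φ)
    {η : ℕ} (hη : 1 ≤ η) {τ : ℝ} (hs : Summable (fun k : ℤ => |poissonMultiplier η τ k|))
    (t : AddCircle (1 : ℝ)) :
    ∑' k : ℤ, (poissonMultiplier η τ k : ℂ) * fourierCoeff φ k * fourier k t =
      ∫ u, (∑' k : ℤ, (poissonMultiplier η τ k : ℂ) * fourier k u) * (φ (t - u) - φ t)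
        ∂AddCircle.haarAddCircle := by
  have hterm : ∀ k : ℤ, (poissonMultiplier η τ k : ℂ) * fourierCoeff φ k * fourier k t =
      ∫ u, (poissonMultiplier η τ k : ℂ) * fourier k u * (φ (t - u) - φ t)
        ∂AddCircle.haarAddCircle := by
    intro k
    rcases eq_or_ne k 0 with rfl | hk
    · simp [poissonMultiplier_zero hη]
    have hzero : ∫ u : AddCircle (1 : ℝ), fourier k u ∂AddCircle.haarAddCircle = 0 :=
      MeasureTheory.integral_eq_zero_of_add_right_eq_neg (fourier_add_half_inv_index hk one_pos)
    have hmain : ∫ u : AddCircle (1 : ℝ), fourier k u * φ (t - u) ∂AddCircle.haarAddCircle =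
        fourierCoeff φ k * fourier k t := by
      rw [← MeasureTheory.integral_sub_left_eq_self _ _ t, fourierCoeff,
        ← MeasureTheory.integral_mul_const]
      refine MeasureTheory.integral_congr_ae (Filter.Eventually.of_forall fun s => ?_)
      have h : fourier k (t - s) = fourier k t * fourier (-k) s := by
        simp only [fourier_apply, sub_eq_add_neg, smul_add, AddCircle.toCircle_add, smul_neg,
          neg_smul, Circle.coe_mul]
      simp only [sub_sub_cancel, h, smul_eq_mul]
      ring
    have hi : ∀ f : AddCircle (1 : ℝ) → ℂ, Continuous f →
        MeasureTheory.Integrable f AddCircle.haarAddCircle := fun f hf =>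
      hf.integrable_of_hasCompactSupport (HasCompactSupport.of_compactSpace f)
    simp_rw [mul_assoc, MeasureTheory.integral_const_mul, mul_sub]
    rw [MeasureTheory.integral_sub (hi _ (by fun_prop)) (hi _ (by fun_prop)), hmain,
      MeasureTheory.integral_mul_const, hzero, zero_mul, sub_zero]
  simp_rw [hterm, ← tsum_mul_right]
  obtain ⟨M, hM⟩ := (isCompact_range (show Continuous fun u => φ (t - u) - φ t by
    fun_prop)).isBounded.exists_norm_le
  refine (MeasureTheory.integral_tsum_of_summable_integral_norm (fun k => ?_) ?_)
  · exact (show Continuous fun u => (poissonMultiplier η τ k : ℂ) * fourier k u *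
      (φ (t - u) - φ t) by fun_prop).integrable_of_hasCompactSupport
      (HasCompactSupport.of_compactSpace _)
  · refine Summable.of_nonneg_of_le (fun k => by positivity) (fun k => ?_) (hs.mul_right M)
    refine (MeasureTheory.integral_mono_of_nonneg (Filter.Eventually.of_forall fun _ => norm_nonneg _)
      (MeasureTheory.integrable_const (|poissonMultiplier η τ k| * M))
      (Filter.Eventually.of_forall fun u => ?_)).trans_eq (by simp)
    simp only [norm_mul, Complex.norm_real, Real.norm_eq_abs]
    have h1 : ‖fourier k u‖ = 1 := Circle.norm_coe _
    rw [h1, mul_one]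
    gcongr
    exact hM _ ⟨u, rfl⟩

lemma integral_add_norm_rpow_le {τ a : ℝ} (hτ : 0 < τ) (ha : 0 < a) :
    ∫ u : AddCircle (1 : ℝ), (τ + ‖u‖) ^ (-a - 1) ∂AddCircle.haarAddCircle ≤
      2 / a * τ ^ (-a) := by
  rw [AddCircle.integral_haarAddCircle, inv_one, one_smul,
    ← AddCircle.intervalIntegral_preimage 1 (-(1 / 2))]
  have hcont : Continuous fun x : ℝ => (τ + |x|) ^ (-a - 1) :=
    (by fun_prop : Continuous fun x : ℝ => τ + |x|).rpow_const
      fun x => Or.inl (by positivity)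
  have hpos : ∫ x in (0 : ℝ)..(1 / 2), (τ + |x|) ^ (-a - 1) ≤ 1 / a * τ ^ (-a) := by
    have h1 : ∫ x in (0 : ℝ)..(1 / 2), (τ + |x|) ^ (-a - 1) =
        ∫ x in (0 : ℝ)..(1 / 2), (τ + x) ^ (-a - 1) := by
      refine intervalIntegral.integral_congr fun x hx => ?_
      rw [Set.uIcc_of_le (by norm_num)] at hx
      simp only [abs_of_nonneg hx.1]
    rw [h1, intervalIntegral.integral_comp_add_left (fun x => x ^ (-a - 1)), integral_rpow]
    · rw [sub_add_cancel, add_zero, div_neg, ← neg_div, neg_sub, div_mul_eq_mul_div, one_mul]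
      gcongr
      have : 0 ≤ (τ + 1 / 2) ^ (-a) := by positivity
      linarith
    · refine Or.inr ⟨by linarith, ?_⟩
      rw [Set.uIcc_of_le (by linarith)]
      exact fun h => by linarith [h.1]
  have hneg : ∫ x in (-(1 / 2) : ℝ)..0, (τ + |x|) ^ (-a - 1) =
      ∫ x in (0 : ℝ)..(1 / 2), (τ + |x|) ^ (-a - 1) := by
    have := intervalIntegral.integral_comp_neg (a := 0) (b := 1 / 2)
      (fun x : ℝ => (τ + |x|) ^ (-a - 1))
    simpa using this.symm
  have hcongr : ∫ x in (-(1 / 2) : ℝ)..(-(1 / 2) + 1), (τ + ‖(x : AddCircle (1 : ℝ))‖) ^ (-a - 1) =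
      ∫ x in (-(1 / 2) : ℝ)..(1 / 2), (τ + |x|) ^ (-a - 1) := by
    rw [show (-(1 / 2) : ℝ) + 1 = 1 / 2 by norm_num]
    refine intervalIntegral.integral_congr fun x hx => ?_
    rw [Set.uIcc_of_le (by norm_num)] at hx
    have : ‖(x : AddCircle (1 : ℝ))‖ = |x| :=
      (AddCircle.norm_coe_eq_abs_iff 1 one_ne_zero).2 (by simpa using abs_le.2 hx)
    simp only [this]
  rw [hcongr, ← intervalIntegral.integral_add_adjacent_intervals
    (hcont.intervalIntegrable (-(1 / 2)) 0) (hcont.intervalIntegrable 0 (1 / 2)), hneg]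
  calc _ ≤ 1 / a * τ ^ (-a) + 1 / a * τ ^ (-a) := add_le_add hpos hpos
    _ = 2 / a * τ ^ (-a) := by ring

/-- Continuous Littlewood–Paley criterion (necessity): if `φ` is `κ`-Hölder
with `κ ∈ (0,1)`, then for every `η ≥ 1` there is `C > 0` such that
`‖(∂/∂τ)^η e^{−τ√(−Δ)} φ‖_∞ ≤ C τ^{κ−η}` for all `τ ∈ (0,1]`. -/
theorem stmt10 (φ : AddCircle (1:ℝ) → ℂ) (hφ : Continuous φ)
    (κ : ℝ) (hκ : κ ∈ Set.Ioo (0:ℝ) 1)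
    (C₀ : ℝ) (hC₀ : 0 < C₀)
    (hHolder : ∀ t s : AddCircle (1:ℝ), ‖φ t - φ s‖ ≤ C₀ * dist t s ^ κ) :
    ∀ η : ℕ, 1 ≤ η → ∃ C : ℝ, 0 < C ∧ ∀ τ : ℝ, τ ∈ Set.Ioc (0:ℝ) 1 →
      ∀ t : AddCircle (1:ℝ),
      ‖∑' k : ℤ, (((-(2 * Real.pi * |(k:ℝ)|))^η * Real.exp (-(2 * Real.pi * τ * |(k:ℝ)|)) : ℝ) : ℂ)
          * fourierCoeff φ k * fourier k t‖ ≤ C * τ ^ (κ - (η:ℝ)) := by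
  intro η hη
  obtain ⟨C, hC, hker⟩ := exists_norm_tsum_poissonMultiplier_le hη
  have ha : 0 < (η : ℝ) - κ := by
    have : (1 : ℝ) ≤ η := by exact_mod_cast hη
    linarith [hκ.2]
  refine ⟨C * C₀ * (2 / (η - κ)), by positivity, fun τ hτ t => ?_⟩
  have hs : Summable (fun k : ℤ => |poissonMultiplier η τ k|) := by
    simpa using (hker τ hτ 0).1.norm
  refine (congrArg norm (tsum_poissonMultiplier_mul_fourierCoeff hφ hη hs t)).trans_le ?_
  have hpow : Continuous fun u : AddCircle (1 : ℝ) => (τ + ‖u‖) ^ (-(η - κ) - 1) :=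
    (by fun_prop : Continuous fun u : AddCircle (1 : ℝ) => τ + ‖u‖).rpow_const
      fun u => Or.inl (by have := hτ.1; positivity)
  calc _ ≤ ∫ u : AddCircle (1 : ℝ), C * C₀ * (τ + ‖u‖) ^ (-(η - κ) - 1)
        ∂AddCircle.haarAddCircle := by
        refine MeasureTheory.norm_integral_le_of_norm_le
          ((continuous_const.mul hpow).integrable_of_hasCompactSupport
            (HasCompactSupport.of_compactSpace _))
          (Filter.Eventually.of_forall fun u => ?_)
        have hpos : 0 < τ + ‖u‖ := add_pos_of_pos_of_nonneg hτ.1 (norm_nonneg u)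
        have hinc : ‖φ (t - u) - φ t‖ ≤ C₀ * (τ + ‖u‖) ^ κ := by
          refine (hHolder _ _).trans ?_
          rw [dist_eq_norm, sub_sub_cancel_left, norm_neg]
          have := hκ.1.le
          gcongr
          linarith [hτ.1]
        rw [norm_mul]
        calc _ ≤ C / (τ + ‖u‖) ^ (η + 1) * (C₀ * (τ + ‖u‖) ^ κ) := by
              gcongr
              exact (hker τ hτ u).2
          _ = C * C₀ * (τ + ‖u‖) ^ (-(η - κ) - 1) := by
              rw [show -((η : ℝ) - κ) - 1 = κ - ((η + 1 : ℕ) : ℝ) by push_cast; ring,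
                Real.rpow_sub hpos, Real.rpow_natCast]
              ring
    _ ≤ C * C₀ * (2 / (η - κ) * τ ^ (-(η - κ))) := by
        rw [MeasureTheory.integral_const_mul]
        gcongr
        exact integral_add_norm_rpow_le hτ.1 ha
    _ = C * C₀ * (2 / (η - κ)) * τ ^ (κ - (η : ℝ)) := by
        rw [neg_sub, ← mul_assoc]
end
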